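/- Let G be a connected block graph in which every block with at least three vertices is an end-block, with spine P of length ℓ(G) ≥ 1, let v be a cut vertex of G maximizing d(v,P) with bd(v) ≥ 3, and let G' be obtained from G by adding all edges between vertices of N_G(v). If d(v,P) = 1, then b(G') = b(G) + 1, and for every u ∈ C_{G'} one has lbd_{G'}(u) = lbd_G(u); consequently Σ_{x ∈ C_G} max{lbd_G(x),2} = Σ_{x ∈ C_{G'}} max{lbd_{G'}(x),2} + max{lbd_G(v),2}. -/

import Mathlib

open MvPolynomial

noncomputable section

namespace BEIReg

variable {V : Type*}

/-- The number of connected components of the subgraph of `G` induced on `W`. -/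
def ncomp (G : SimpleGraph V) (W : Set V) : ℕ :=
  Nat.card (G.induce W).ConnectedComponent

/-- `v` is a cut vertex of the subgraph of `G` induced on the vertex set `W`:
deleting it strictly increases the number of connected components. -/
def IsCutVtx (G : SimpleGraph V) (W : Set V) (v : V) : Prop :=
  v ∈ W ∧ ncomp G W < ncomp G (W \ {v})

/-- `B` is a block of the subgraph of `G` induced on `W`: a maximal (vertex set of a)
connected induced subgraph without cut vertices. -/
def IsBlockOn (G : SimpleGraph V) (W : Set V) (B : Set V) : Prop :=
  B ⊆ W ∧ (G.induce B).Connected ∧ (∀ w, ¬ IsCutVtx G B w) ∧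
    ∀ B', B ⊆ B' → B' ⊆ W → (G.induce B').Connected → (∀ w, ¬ IsCutVtx G B' w) → B' = B

/-- The subgraph of `G` induced on `W` is a block graph: every block is a complete graph. -/
def IsBlockGraphOn (G : SimpleGraph V) (W : Set V) : Prop :=
  ∀ B, IsBlockOn G W B → G.IsClique B

/-- An end-block: a block containing at most one cut vertex. -/
def IsEndBlockOn (G : SimpleGraph V) (W : Set V) (B : Set V) : Prop :=
  IsBlockOn G W B ∧ {x ∈ B | IsCutVtx G W x}.Subsingleton

/-- The block degree of `v`: the number of blocks incident to `v`. -/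
def bd (G : SimpleGraph V) (W : Set V) (v : V) : ℕ :=
  {B : Set V | IsBlockOn G W B ∧ v ∈ B}.ncard

/-- The large block degree of `v`: the number of blocks with at least three
vertices incident to `v`. -/
def lbd (G : SimpleGraph V) (W : Set V) (v : V) : ℕ :=
  {B : Set V | IsBlockOn G W B ∧ v ∈ B ∧ 3 ≤ B.ncard}.ncard

/-- `P` is a path of the subgraph of `G` induced on `W`. -/
def IsPathOn (G : SimpleGraph V) (W : Set V) {a b : V} (P : G.Walk a b) : Prop :=
  P.IsPath ∧ ∀ x ∈ P.support, x ∈ W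

/-- `P` is a spine of the subgraph of `G` induced on `W`: a maximum length path
each of whose edges is a block. -/
def IsSpineOn (G : SimpleGraph V) (W : Set V) {a b : V} (P : G.Walk a b) : Prop :=
  IsPathOn G W P ∧ (∀ e ∈ P.edges, IsBlockOn G W {x | x ∈ e}) ∧
    ∀ ⦃c d : V⦄ (Q : G.Walk c d), IsPathOn G W Q →
      (∀ e ∈ Q.edges, IsBlockOn G W {x | x ∈ e}) → Q.length ≤ P.length

/-- `e₂`: the number of edges of `G[W]` off the path `P` both of whose endpoints have
block degree at most `2`. -/
def e2 (G : SimpleGraph V) (W : Set V) {a b : V} (P : G.Walk a b) : ℕ :=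
  {e : Sym2 V | e ∈ G.edgeSet ∧ (∀ x ∈ e, x ∈ W) ∧ e ∉ P.edges ∧
    ∀ x ∈ e, bd G W x ≤ 2}.ncard

/-- `C_G`: the set of vertices off the path `P` of block degree at least `3`. -/
def Cset (G : SimpleGraph V) (W : Set V) {a b : V} (P : G.Walk a b) : Set V :=
  {x | x ∈ W ∧ x ∉ P.support ∧ 3 ≤ bd G W x}

/-- `b(G)`: the number of large (≥ 3 vertices) end-blocks meeting the path `P`. -/
def bcount (G : SimpleGraph V) (W : Set V) {a b : V} (P : G.Walk a b) : ℕ :=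
  {B : Set V | IsEndBlockOn G W B ∧ 3 ≤ B.ncard ∧ ∃ x ∈ B, x ∈ P.support}.ncard

/-- Graph distance between `x` and `y` inside the induced subgraph on `W`. -/
def distOn (G : SimpleGraph V) (W : Set V) (x y : V) : ℕ :=
  sInf {n | ∃ Q : G.Walk x y, (∀ z ∈ Q.support, z ∈ W) ∧ Q.length = n}

/-- Distance `d(x, P)` from a vertex `x` to the path `P`, inside `G[W]`. -/
def distToPath (G : SimpleGraph V) (W : Set V) {a b : V} (P : G.Walk a b) (x : V) : ℕ :=
  sInf {n | ∃ y ∈ P.support, distOn G W x y = n}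

/-- `d(G) = Σ_{x cut vertex} d(x, P)`. -/
def dsum (G : SimpleGraph V) (W : Set V) {a b : V} (P : G.Walk a b) : ℕ :=
  ∑ᶠ x ∈ {x | IsCutVtx G W x}, distToPath G W P x

/-- A free vertex: a vertex lying in exactly one maximal clique of `G[W]`. -/
def IsFreeVtx (G : SimpleGraph V) (W : Set V) (v : V) : Prop :=
  {C : Set V | C ⊆ W ∧ G.IsClique C ∧ (∀ D, D ⊆ W → G.IsClique D → C ⊆ D → D = C) ∧
    v ∈ C}.ncard = 1

/-- The graph `G'` obtained from `G` by adding all edges between vertices of `N_G(v)`. -/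
def addCliqueOnNbhd (G : SimpleGraph V) (v : V) : SimpleGraph V :=
  G ⊔ SimpleGraph.fromRel (fun x y => G.Adj v x ∧ G.Adj v y)

lemma le_addCliqueOnNbhd (G : SimpleGraph V) (v : V) : G ≤ addCliqueOnNbhd G v :=
  le_sup_left

/-- The binomial edge ideal of a graph `G` on the vertex set `V`, inside the
polynomial ring `K[x_i, y_i : i ∈ V]` (the first summand giving the `x` variables and
the second the `y` variables). -/
def binomialEdgeIdeal (K : Type*) [Field K] (G : SimpleGraph V) :
    Ideal (MvPolynomial (V ⊕ V) K) :=
  Ideal.span {f | ∃ i j : V, G.Adj i j ∧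
    f = X (Sum.inl i) * X (Sum.inr j) - X (Sum.inl j) * X (Sum.inr i)}

/-- A graded free resolution of `S/I`, where `S` is a polynomial ring: free modules
`F i = S^{rank i}` whose `j`-th generator sits in degree `deg i j`, with degree-preserving
differentials, resolving `S ⧸ I`. -/
structure GradedFreeResolution {K : Type*} [CommRing K] {σ : Type*}
    (I : Ideal (MvPolynomial σ K)) where
  rank : ℕ → ℕ
  deg : (i : ℕ) → Fin (rank i) → ℕ
  d : (i : ℕ) → ((Fin (rank (i + 1)) → MvPolynomial σ K) →ₗ[MvPolynomial σ K]
        (Fin (rank i) → MvPolynomial σ K))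
  aug : (Fin (rank 0) → MvPolynomial σ K) →ₗ[MvPolynomial σ K] (MvPolynomial σ K ⧸ I)
  aug_surjective : Function.Surjective aug
  aug_graded : ∀ j, ∃ p : MvPolynomial σ K, p.IsHomogeneous (deg 0 j) ∧
      aug (Pi.single j 1) = Ideal.Quotient.mk I p
  d_graded : ∀ i (j : Fin (rank (i + 1))) (j' : Fin (rank i)),
      d i (Pi.single j 1) j' = 0 ∨
        (deg i j' ≤ deg (i + 1) j ∧
          (d i (Pi.single j 1) j').IsHomogeneous (deg (i + 1) j - deg i j'))
  exact_zero : Function.Exact ⇑(d 0) ⇑aug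
  exact_succ : ∀ i, Function.Exact ⇑(d (i + 1)) ⇑(d i)

/-- The Castelnuovo–Mumford regularity of `S ⧸ I` for a homogeneous ideal `I` of a
polynomial ring `S`: the least `r` such that `S ⧸ I` admits a graded free resolution
whose `i`-th twists are all at most `i + r`. -/
def regQuot {K : Type*} [CommRing K] {σ : Type*} (I : Ideal (MvPolynomial σ K)) : ℕ :=
  sInf {r : ℕ | ∃ F : GradedFreeResolution I, ∀ i j, F.deg i j ≤ i + r}

/-- The set of vertices of `W` reachable from `a` by a walk of `G` staying inside `W`,
i.e. the connected component of `G[W]` containing `a`. -/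
def reachIn (G : SimpleGraph V) (W : Set V) (a : V) : Set V :=
  {x | x ∈ W ∧ ∃ Q : G.Walk x a, ∀ z ∈ Q.support, z ∈ W}

/-- The flower graph `F_{h,k}(v)`: `h` triangles and `k` stars `K_{1,3}`, each glued
at a free vertex (a leaf of the star) to the common vertex `v = Sum.inl ()`.
The vertex `Sum.inr (Sum.inr (s, 0))` is the center of the `s`-th star. -/
def flower (h k : ℕ) : SimpleGraph (Unit ⊕ (Fin h × Fin 2) ⊕ (Fin k × Fin 3)) :=
  SimpleGraph.fromRel (fun x y =>
    (∃ t : Fin h, ∃ i : Fin 2, x = Sum.inl () ∧ y = Sum.inr (Sum.inl (t, i))) ∨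
    (∃ t : Fin h, x = Sum.inr (Sum.inl (t, 0)) ∧ y = Sum.inr (Sum.inl (t, 1))) ∨
    (∃ s : Fin k, x = Sum.inl () ∧ y = Sum.inr (Sum.inr (s, 0))) ∨
    (∃ s : Fin k, ∃ j : Fin 3, j ≠ 0 ∧
      x = Sum.inr (Sum.inr (s, 0)) ∧ y = Sum.inr (Sum.inr (s, j))))


/-- Two vertices of `S` joined by a walk inside `S` are reachable in the induced subgraph. -/
lemma reachable_induce_of_walk {G : SimpleGraph V} {S : Set V} {x y : V} (Q : G.Walk x y)
    (hQ : ∀ z ∈ Q.support, z ∈ S) (hx : x ∈ S) (hy : y ∈ S) :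
    (G.induce S).Reachable ⟨x, hx⟩ ⟨y, hy⟩ :=
  ⟨Q.induce S hQ⟩

lemma reachable_induce_of_adj {G : SimpleGraph V} {S : Set V} {x y : V} (h : G.Adj x y)
    (hx : x ∈ S) (hy : y ∈ S) : (G.induce S).Reachable ⟨x, hx⟩ ⟨y, hy⟩ :=
  SimpleGraph.Adj.reachable (SimpleGraph.induce_adj.2 h)

lemma exists_walk_of_reachable_induce {G : SimpleGraph V} {S : Set V} {x y : S}
    (h : (G.induce S).Reachable x y) : ∃ Q : G.Walk x y, ∀ z ∈ Q.support, z ∈ S := by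
  obtain ⟨Q⟩ := h
  induction Q with
  | nil => exact ⟨.nil, by simp⟩
  | @cons x z y h Q ih =>
    obtain ⟨R, hR⟩ := ih
    exact ⟨.cons (SimpleGraph.induce_adj.1 h) R, by simpa using hR⟩

lemma preconnected_induce_of_isClique {G : SimpleGraph V} {S : Set V} (h : G.IsClique S) :
    (G.induce S).Preconnected := by
  rintro ⟨x, hx⟩ ⟨y, hy⟩
  rcases eq_or_ne x y with rfl | hne
  · rfl
  · exact reachable_induce_of_adj (h hx hy hne) hx hy

lemma ncomp_le_one_iff [Finite V] {G : SimpleGraph V} {S : Set V} :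
    ncomp G S ≤ 1 ↔ (G.induce S).Preconnected := by
  unfold ncomp
  rw [Finite.card_le_one_iff_subsingleton]
  constructor
  · intro h x y
    exact SimpleGraph.ConnectedComponent.exact (Subsingleton.elim _ _)
  · exact fun h => h.subsingleton_connectedComponent

lemma ncomp_eq_one [Finite V] {G : SimpleGraph V} {S : Set V} (h : (G.induce S).Connected) :
    ncomp G S = 1 := by
  refine le_antisymm (ncomp_le_one_iff.2 h.preconnected) ?_
  have := h.nonempty
  exact Nat.card_pos

lemma isCutVtx_iff [Finite V] {G : SimpleGraph V} {S : Set V} (h : (G.induce S).Connected)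
    {w : V} (hw : w ∈ S) : IsCutVtx G S w ↔ ¬ (G.induce (S \ {w})).Preconnected := by
  rw [IsCutVtx, ncomp_eq_one h, ← ncomp_le_one_iff]
  simp [hw]

lemma connected_induce_univ {G : SimpleGraph V} (h : G.Connected) :
    (G.induce Set.univ).Connected :=
  (SimpleGraph.induceUnivIso G).connected_iff.2 h

lemma isCutVtx_univ_iff [Finite V] {G : SimpleGraph V} (h : G.Connected) {w : V} :
    IsCutVtx G Set.univ w ↔ ¬ (G.induce {w}ᶜ).Preconnected := by
  rw [isCutVtx_iff (connected_induce_univ h) (Set.mem_univ w), Set.compl_eq_univ_sdiff]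

/-- A connected induced subgraph without cut vertices. -/
def IsBiconn (G : SimpleGraph V) (S : Set V) : Prop :=
  (G.induce S).Connected ∧ ∀ w, ¬ IsCutVtx G S w

lemma isBlockOn_univ_iff {G : SimpleGraph V} {B : Set V} :
    IsBlockOn G Set.univ B ↔ Maximal (IsBiconn G) B := by
  constructor
  · rintro ⟨-, h1, h2, h3⟩
    exact ⟨⟨h1, h2⟩, fun C hC hBC => (h3 C hBC (Set.subset_univ _) hC.1 hC.2).le⟩
  · rintro ⟨⟨h1, h2⟩, h3⟩
    exact ⟨Set.subset_univ _, h1, h2, fun C hBC _ hC hC' => (h3 ⟨hC, hC'⟩ hBC).antisymm hBC⟩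

lemma isBiconn_of_isClique [Finite V] {G : SimpleGraph V} {S : Set V} (h : G.IsClique S)
    (hS : S.Nonempty) : IsBiconn G S := by
  have hc : (G.induce S).Connected :=
    { preconnected := preconnected_induce_of_isClique h, nonempty := hS.to_subtype }
  refine ⟨hc, fun w hw => ?_⟩
  exact (isCutVtx_iff hc hw.1).1 hw
    (preconnected_induce_of_isClique (h.subset Set.sdiff_subset))

lemma IsBiconn.exists_isBlockOn [Finite V] {G : SimpleGraph V} {S : Set V} (h : IsBiconn G S) :
    ∃ B, S ⊆ B ∧ IsBlockOn G Set.univ B := by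
  obtain ⟨B, hSB, hB⟩ := Finite.exists_le_maximal h
  exact ⟨B, hSB, isBlockOn_univ_iff.2 hB⟩

lemma exists_isBlockOn_of_isClique [Finite V] {G : SimpleGraph V} {S : Set V}
    (h : G.IsClique S) (hS : S.Nonempty) : ∃ B, S ⊆ B ∧ IsBlockOn G Set.univ B :=
  (isBiconn_of_isClique h hS).exists_isBlockOn

lemma exists_isBlockOn_of_adj [Finite V] {G : SimpleGraph V} {x y : V} (h : G.Adj x y) :
    ∃ B, IsBlockOn G Set.univ B ∧ x ∈ B ∧ y ∈ B := by
  obtain ⟨B, hB, hBB⟩ := exists_isBlockOn_of_isClique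
    (SimpleGraph.isClique_pair.2 fun _ => h) (Set.insert_nonempty x {y})
  exact ⟨B, hBB, hB (by simp), hB (by simp)⟩

lemma IsBlockOn.nonempty {G : SimpleGraph V} {W B : Set V} (hB : IsBlockOn G W B) :
    B.Nonempty :=
  Set.nonempty_coe_sort.1 hB.2.1.nonempty

lemma IsBlockOn.eq_of_isClique [Finite V] {G : SimpleGraph V} {B C : Set V}
    (hB : IsBlockOn G Set.univ B) (hC : G.IsClique C) (hBC : B ⊆ C) : C = B :=
  have h := isBiconn_of_isClique hC (hB.nonempty.mono hBC)
  hB.2.2.2 C hBC (Set.subset_univ _) h.1 h.2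

/-- In a block graph the blocks are the nonempty maximal cliques. -/
lemma IsBlockGraphOn.isBlockOn_of_maximal [Finite V] {G : SimpleGraph V}
    (hG : IsBlockGraphOn G Set.univ) {B : Set V} (hB : G.IsClique B) (hne : B.Nonempty)
    (hmax : ∀ C, G.IsClique C → B ⊆ C → C ⊆ B) : IsBlockOn G Set.univ B := by
  obtain ⟨C, hBC, hC⟩ := exists_isBlockOn_of_isClique hB hne
  rwa [hBC.antisymm (hmax C (hG C hC) hBC)]

lemma IsBlockGraphOn.isClique_of_isBiconn [Finite V] {G : SimpleGraph V}
    (hG : IsBlockGraphOn G Set.univ) {S : Set V} (hS : IsBiconn G S) : G.IsClique S := by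
  obtain ⟨B, hSB, hB⟩ := hS.exists_isBlockOn
  exact (hG B hB).subset hSB

/-- A path together with a vertex adjacent to both of its ends has no cut vertex. -/
lemma isBiconn_insert_support [Finite V] {G : SimpleGraph V} {u x y : V} (hx : G.Adj u x)
    (hy : G.Adj u y) (Q : G.Walk x y) (hQ : Q.IsPath) (hu : u ∉ Q.support) :
    IsBiconn G (insert u {z | z ∈ Q.support}) := by
  set S : Set V := insert u {z | z ∈ Q.support} with hS
  have hQS : ∀ z ∈ Q.support, z ∈ S := fun z hz => Or.inr hz
  have huS : u ∈ S := Or.inl rfl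
  have hxS : x ∈ S := hQS x Q.start_mem_support
  have hyS : y ∈ S := hQS y Q.end_mem_support
  have hconn : (G.induce S).Connected := by
    have : ∀ z (hz : z ∈ S), (G.induce S).Reachable ⟨z, hz⟩ ⟨u, huS⟩ := by
      classical
      intro z hz
      rcases hz with rfl | hz
      · rfl
      · exact (reachable_induce_of_walk (Q.takeUntil z hz).reverse
          (fun t ht => hQS t (Q.support_takeUntil_subset_support hz (by simpa using ht)))
          _ hxS).trans (reachable_induce_of_adj hx.symm hxS huS)
    exact { preconnected := fun p q => (this p p.2).trans (this q q.2).symm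
            nonempty := ⟨⟨u, huS⟩⟩ }
  refine ⟨hconn, fun w hw => (isCutVtx_iff hconn hw.1).1 hw ?_⟩
  by_cases hwu : w = u
  · subst hwu
    have hsub : ∀ z ∈ Q.support, z ∈ S \ {w} := fun z hz => ⟨hQS z hz, by
      rintro rfl; exact hu hz⟩
    have : ∀ z (hz : z ∈ S \ {w}), (G.induce (S \ {w})).Reachable ⟨z, hz⟩
        ⟨x, hsub x Q.start_mem_support⟩ := by
      classical
      rintro z ⟨hz | hz, hzw⟩
      · exact absurd hz hzw
      · exact reachable_induce_of_walk (Q.takeUntil z hz).reverse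
          (fun t ht => hsub t (Q.support_takeUntil_subset_support hz (by simpa using ht))) _ _
    exact fun p q => (this p p.2).trans (this q q.2).symm
  · have huw : u ∈ S \ {w} := ⟨huS, fun h => hwu h.symm⟩
    have : ∀ z (hz : z ∈ S \ {w}), (G.induce (S \ {w})).Reachable ⟨z, hz⟩ ⟨u, huw⟩ := by
      rintro z ⟨hz | hz, hzw⟩
      · subst hz; rfl
      · obtain ⟨q, r, -, -, rfl⟩ := hQ.mem_support_iff_exists_append.1 hz
        by_cases hwq : w ∈ q.support
        · have hr : ∀ t ∈ r.support, t ∈ S \ {w} := fun t ht =>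
            ⟨hQS t (by simp [ht]), by
              rintro rfl
              exact hQ.ne_of_mem_support_of_append (fun h => hzw h.symm) hwq ht rfl⟩
          exact (reachable_induce_of_walk r hr _ (hr y r.end_mem_support)).trans
            (reachable_induce_of_adj hy.symm _ huw)
        · have hq : ∀ t ∈ q.support, t ∈ S \ {w} := fun t ht =>
            ⟨hQS t (by simp [ht]), by rintro rfl; exact hwq ht⟩
          exact (reachable_induce_of_walk q.reverse (by simpa using hq) _
            (hq x q.start_mem_support)).trans (reachable_induce_of_adj hx.symm _ huw)
    exact fun p q => (this p p.2).trans (this q q.2).symm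

/-- In a block graph, distinct neighbours of `u` joined by a walk avoiding `u` are adjacent. -/
lemma IsBlockGraphOn.adj_of_walk [Finite V] {G : SimpleGraph V}
    (hG : IsBlockGraphOn G Set.univ) {u x y : V} (hx : G.Adj u x) (hy : G.Adj u y)
    (hne : x ≠ y) (Q : G.Walk x y) (hu : u ∉ Q.support) : G.Adj x y := by
  classical
  have := hG.isClique_of_isBiconn (isBiconn_insert_support hx hy Q.bypass Q.bypass_isPath
    fun h => hu (Q.support_bypass_subset_support h))
  exact this (Or.inr Q.bypass.start_mem_support) (Or.inr Q.bypass.end_mem_support) hne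

/-- In a connected block graph, a vertex on two blocks is a cut vertex. -/
lemma IsBlockGraphOn.isCutVtx_of_mem_of_mem [Finite V] {G : SimpleGraph V}
    (hG : IsBlockGraphOn G Set.univ) (hconn : G.Connected) {B C : Set V}
    (hB : IsBlockOn G Set.univ B) (hC : IsBlockOn G Set.univ C) (hne : B ≠ C) {u : V}
    (huB : u ∈ B) (huC : u ∈ C) : IsCutVtx G Set.univ u := by
  rw [isCutVtx_univ_iff hconn]
  intro hpre
  apply hne
  have hadj : ∀ x ∈ B, ∀ y ∈ C, x ≠ y → G.Adj x y := by
    intro x hx y hy hxy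
    rcases eq_or_ne x u with rfl | hxu
    · exact hG C hC huC hy hxy
    rcases eq_or_ne y u with rfl | hyu
    · exact hG B hB hx huB hxy
    have hxu' : x ∈ ({u}ᶜ : Set V) := hxu
    have hyu' : y ∈ ({u}ᶜ : Set V) := hyu
    obtain ⟨Q, hQ⟩ := exists_walk_of_reachable_induce (hpre ⟨x, hxu'⟩ ⟨y, hyu'⟩)
    exact hG.adj_of_walk (hG B hB huB hx hxu.symm) (hG C hC huC hy hyu.symm) hxy Q
      fun h => hQ u h rfl
  have hcl : G.IsClique (B ∪ C) := by
    rintro x (hx | hx) y (hy | hy) hxy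
    · exact hG B hB hx hy hxy
    · exact hadj x hx y hy hxy
    · exact (hadj y hy x hx hxy.symm).symm
    · exact hG C hC hx hy hxy
  rw [← hB.eq_of_isClique hcl Set.subset_union_left,
    hC.eq_of_isClique hcl Set.subset_union_right]

/-- A vertex whose neighbourhood is a clique is not a cut vertex. -/
lemma not_isCutVtx_of_isClique_neighborSet [Finite V] {G : SimpleGraph V}
    (hconn : G.Connected) {u : V} (hu : G.IsClique (G.neighborSet u)) :
    ¬ IsCutVtx G Set.univ u := by
  rw [isCutVtx_univ_iff hconn, not_not]
  have key : ∀ {x y : V} (_ : G.Walk x y) (hy : y ∈ ({u}ᶜ : Set V)),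
      (∀ hx : x ∈ ({u}ᶜ : Set V), (G.induce {u}ᶜ).Reachable ⟨x, hx⟩ ⟨y, hy⟩) ∧
      (x = u → ∀ c (hc : c ∈ ({u}ᶜ : Set V)), G.Adj u c →
        (G.induce {u}ᶜ).Reachable ⟨c, hc⟩ ⟨y, hy⟩) := by
    intro x y Q hy
    induction Q with
    | nil => exact ⟨fun _ => .rfl, fun h => absurd h hy⟩
    | @cons x z y h Q ih =>
      obtain ⟨ih1, ih2⟩ := ih hy
      refine ⟨fun hx => ?_, ?_⟩
      · by_cases hz : z = u
        · exact ih2 hz x hx (hz ▸ h.symm)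
        · exact (reachable_induce_of_adj h hx hz).trans (ih1 hz)
      · rintro rfl c hc hac
        have hz : z ∈ ({x}ᶜ : Set V) := h.ne'
        rcases eq_or_ne c z with rfl | hcz
        · exact ih1 hc
        · exact (reachable_induce_of_adj (hu hac h hcz) hc hz).trans (ih1 hz)
  rintro ⟨x, hx⟩ ⟨y, hy⟩
  obtain ⟨Q⟩ := hconn.preconnected x y
  exact (key Q hy).1 hx

lemma IsCutVtx.of_le [Finite V] {G H : SimpleGraph V} (hGH : G ≤ H) (hG : G.Connected) {u : V}
    (h : IsCutVtx H Set.univ u) : IsCutVtx G Set.univ u := by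
  rw [isCutVtx_univ_iff (hG.mono hGH)] at h
  rw [isCutVtx_univ_iff hG]
  exact fun h' => h (h'.mono fun _ _ hab => hGH hab)

/-- A vertex with block degree at least two is a cut vertex of a connected block graph. -/
lemma IsBlockGraphOn.isCutVtx_of_one_lt_bd [Finite V] {G : SimpleGraph V}
    (hG : IsBlockGraphOn G Set.univ) (hconn : G.Connected) {u : V}
    (h : 1 < bd G Set.univ u) : IsCutVtx G Set.univ u := by
  obtain ⟨B, C, hB, hC, hne⟩ := (Set.one_lt_ncard_iff (Set.toFinite _)).1 h
  exact hG.isCutVtx_of_mem_of_mem hconn hB.1 hC.1 hne hB.2 hC.2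

lemma exists_walk_of_distOn_eq {G : SimpleGraph V} (hconn : G.Connected) {x y : V} {n : ℕ}
    (h : distOn G Set.univ x y = n) : ∃ Q : G.Walk x y, Q.length = n := by
  have hne : {n | ∃ Q : G.Walk x y, (∀ z ∈ Q.support, z ∈ Set.univ) ∧ Q.length = n}.Nonempty := by
    obtain ⟨Q⟩ := hconn.preconnected x y
    exact ⟨Q.length, Q, fun _ _ => Set.mem_univ _, rfl⟩
  obtain ⟨Q, -, hQ⟩ := Nat.sInf_mem hne
  exact ⟨Q, hQ.trans h⟩

lemma exists_walk_length_eq_distToPath {G : SimpleGraph V} (hconn : G.Connected) {a b : V}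
    (P : G.Walk a b) (x : V) :
    ∃ y ∈ P.support, ∃ Q : G.Walk x y, Q.length = distToPath G Set.univ P x := by
  have hne : {n | ∃ y ∈ P.support, distOn G Set.univ x y = n}.Nonempty :=
    ⟨_, a, P.start_mem_support, rfl⟩
  obtain ⟨y, hy, h⟩ := Nat.sInf_mem hne
  exact ⟨y, hy, exists_walk_of_distOn_eq hconn h⟩

lemma distToPath_eq_zero_of_mem {G : SimpleGraph V} {a b : V} {P : G.Walk a b} {x : V}
    (hx : x ∈ P.support) : distToPath G Set.univ P x = 0 := by
  refine Nat.sInf_eq_zero.2 (Or.inl ⟨x, hx, Nat.sInf_eq_zero.2 (Or.inl ?_)⟩)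
  exact ⟨.nil, fun _ _ => Set.mem_univ _, rfl⟩

/-- The graph obtained by completing the neighbourhood of `v`: adjacency. -/
lemma addCliqueOnNbhd_adj {G : SimpleGraph V} {v x y : V} :
    (addCliqueOnNbhd G v).Adj x y ↔ G.Adj x y ∨ (x ≠ y ∧ G.Adj v x ∧ G.Adj v y) := by
  simp only [addCliqueOnNbhd, SimpleGraph.sup_adj, SimpleGraph.fromRel_adj]
  tauto

section CompletedNeighbourhood

variable {G : SimpleGraph V} {v w : V}

lemma isClique_addCliqueOnNbhd_insert_neighborSet :
    (addCliqueOnNbhd G v).IsClique (insert v (G.neighborSet v)) := by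
  rintro x (rfl | hx) y (rfl | hy) hxy
  · exact absurd rfl hxy
  · exact addCliqueOnNbhd_adj.2 (Or.inl hy)
  · exact addCliqueOnNbhd_adj.2 (Or.inl hx.symm)
  · exact addCliqueOnNbhd_adj.2 (Or.inr ⟨hxy, hx, hy⟩)

/-- If the neighbours of `v` other than `w` have all their neighbours in the closed
neighbourhood of `v`, then so do they after completing the neighbourhood of `v`. -/
lemma mem_insert_neighborSet_of_addCliqueOnNbhd_adj
    (hout : ∀ x, G.Adj v x → x ≠ w → ∀ z, G.Adj x z → z ∈ insert v (G.neighborSet v))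
    {x z : V} (hx : x ∈ insert v (G.neighborSet v)) (hxw : x ≠ w)
    (h : (addCliqueOnNbhd G v).Adj x z) : z ∈ insert v (G.neighborSet v) := by
  rcases addCliqueOnNbhd_adj.1 h with h | ⟨-, -, h⟩
  · rcases hx with hx | hx
    · exact Or.inr (hx ▸ h)
    · exact hout x hx hxw z h
  · exact Or.inr h

lemma adj_of_addCliqueOnNbhd_adj {S : Set V}
    (hS : ∀ x ∈ S, x ∈ insert v (G.neighborSet v) → x = w) {x y : V} (hx : x ∈ S) (hy : y ∈ S)
    (h : (addCliqueOnNbhd G v).Adj x y) : G.Adj x y := by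
  rcases addCliqueOnNbhd_adj.1 h with h | ⟨hne, h1, h2⟩
  · exact h
  · exact absurd ((hS x hx (Or.inr h1)).trans (hS y hy (Or.inr h2)).symm) hne

lemma induce_addCliqueOnNbhd {S : Set V}
    (hS : ∀ x ∈ S, x ∈ insert v (G.neighborSet v) → x = w) :
    (addCliqueOnNbhd G v).induce S = G.induce S := by
  ext x y
  exact ⟨adj_of_addCliqueOnNbhd_adj hS x.2 y.2, fun h => addCliqueOnNbhd_adj.2 (Or.inl h)⟩

lemma isBlockGraphOn_addCliqueOnNbhd [Finite V] (hG : IsBlockGraphOn G Set.univ)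
    (hw : G.Adj v w)
    (hout : ∀ x, G.Adj v x → x ≠ w → ∀ z, G.Adj x z → z ∈ insert v (G.neighborSet v)) :
    IsBlockGraphOn (addCliqueOnNbhd G v) Set.univ := by
  intro S hSb
  obtain ⟨hconn, hcut⟩ : IsBiconn (addCliqueOnNbhd G v) S := ⟨hSb.2.1, hSb.2.2.1⟩
  by_cases hS : ∀ x ∈ S, x ∈ insert v (G.neighborSet v) → x = w
  · have hbi : IsBiconn G S := by
      refine ⟨by rwa [← induce_addCliqueOnNbhd hS], fun u hu => hcut u ⟨hu.1, ?_⟩⟩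
      have hS' : ∀ x ∈ S \ {u}, x ∈ insert v (G.neighborSet v) → x = w :=
        fun x hx => hS x hx.1
      rw [ncomp, ncomp, induce_addCliqueOnNbhd hS, induce_addCliqueOnNbhd hS']
      exact hu.2
    exact (hG.isClique_of_isBiconn hbi).mono (le_addCliqueOnNbhd G v)
  · push Not at hS
    obtain ⟨x, hxS, hxK, hxw⟩ := hS
    refine isClique_addCliqueOnNbhd_insert_neighborSet.subset fun y hyS => ?_
    rcases eq_or_ne y w with rfl | hyw
    · exact Or.inr hw
    have hpre : ((addCliqueOnNbhd G v).induce (S \ {w})).Preconnected := by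
      by_cases hwS : w ∈ S
      · exact not_not.1 fun h => hcut w ((isCutVtx_iff hconn hwS).2 h)
      · rw [Set.sdiff_singleton_eq_self hwS]
        exact hconn.preconnected
    obtain ⟨Q, hQ⟩ := exists_walk_of_reachable_induce (hpre ⟨x, hxS, hxw⟩ ⟨y, hyS, hyw⟩)
    have key : ∀ {p q : V} (Q : (addCliqueOnNbhd G v).Walk p q), (∀ z ∈ Q.support, z ≠ w) →
        p ∈ insert v (G.neighborSet v) → q ∈ insert v (G.neighborSet v) := by
      intro p q Q hQ hp
      induction Q with
      | nil => exact hp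
      | cons h Q ih =>
        simp only [SimpleGraph.Walk.support_cons, List.mem_cons, forall_eq_or_imp] at hQ
        exact ih hQ.2 (mem_insert_neighborSet_of_addCliqueOnNbhd_adj hout hp hQ.1 h)
    exact key Q (fun z hz => (hQ z hz).2) hxK

/-- A block of the completed graph through a vertex of `N[v]` other than `w` is `N[v]`. -/
lemma IsBlockOn.eq_insert_neighborSet [Finite V] (hG : IsBlockGraphOn G Set.univ)
    (hw : G.Adj v w)
    (hout : ∀ x, G.Adj v x → x ≠ w → ∀ z, G.Adj x z → z ∈ insert v (G.neighborSet v))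
    {B : Set V} (hB : IsBlockOn (addCliqueOnNbhd G v) Set.univ B) {x : V} (hxB : x ∈ B)
    (hx : x ∈ insert v (G.neighborSet v)) (hxw : x ≠ w) : B = insert v (G.neighborSet v) := by
  refine (hB.eq_of_isClique isClique_addCliqueOnNbhd_insert_neighborSet fun y hy => ?_).symm
  rcases eq_or_ne x y with rfl | hxy
  · exact hx
  · exact mem_insert_neighborSet_of_addCliqueOnNbhd_adj hout hx hxw
      (isBlockGraphOn_addCliqueOnNbhd hG hw hout B hB hxB hy hxy)

lemma isBlockOn_addCliqueOnNbhd_insert_neighborSet [Finite V] (hG : IsBlockGraphOn G Set.univ)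
    (hw : G.Adj v w)
    (hout : ∀ x, G.Adj v x → x ≠ w → ∀ z, G.Adj x z → z ∈ insert v (G.neighborSet v)) :
    IsBlockOn (addCliqueOnNbhd G v) Set.univ (insert v (G.neighborSet v)) := by
  obtain ⟨B, hKB, hB⟩ := exists_isBlockOn_of_isClique
    (isClique_addCliqueOnNbhd_insert_neighborSet (G := G) (v := v)) (Set.insert_nonempty _ _)
  rwa [← hB.eq_insert_neighborSet hG hw hout (hKB (Set.mem_insert _ _)) (Set.mem_insert _ _)
    hw.ne]

/-- The blocks of the completed graph are `N[v]` and the blocks of `G` avoiding `v`. -/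
lemma isBlockOn_addCliqueOnNbhd_iff [Finite V] (hG : IsBlockGraphOn G Set.univ)
    (hw : G.Adj v w)
    (hout : ∀ x, G.Adj v x → x ≠ w → ∀ z, G.Adj x z → z ∈ insert v (G.neighborSet v))
    {B : Set V} : IsBlockOn (addCliqueOnNbhd G v) Set.univ B ↔
      B = insert v (G.neighborSet v) ∨ (IsBlockOn G Set.univ B ∧ v ∉ B) := by
  constructor
  · intro hB
    by_cases hS : ∀ x ∈ B, x ∈ insert v (G.neighborSet v) → x = w
    · have hcl : G.IsClique B := fun x hx y hy hxy =>
        adj_of_addCliqueOnNbhd_adj hS hx hy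
          (isBlockGraphOn_addCliqueOnNbhd hG hw hout B hB hx hy hxy)
      exact Or.inr ⟨hG.isBlockOn_of_maximal hcl hB.nonempty fun C hC hBC =>
        (hB.eq_of_isClique (hC.mono (le_addCliqueOnNbhd G v)) hBC).le,
        fun hv => hw.ne (hS v hv (Set.mem_insert _ _))⟩
    · push Not at hS
      obtain ⟨x, hxB, hxK, hxw⟩ := hS
      exact Or.inl (hB.eq_insert_neighborSet hG hw hout hxB hxK hxw)
  · rintro (rfl | ⟨hB, hv⟩)
    · exact isBlockOn_addCliqueOnNbhd_insert_neighborSet hG hw hout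
    obtain ⟨C, hBC, hC⟩ := exists_isBlockOn_of_isClique
      ((hG B hB).mono (le_addCliqueOnNbhd G v)) hB.nonempty
    suffices C = B from this ▸ hC
    by_cases hS : ∀ x ∈ C, x ∈ insert v (G.neighborSet v) → x = w
    · refine hB.eq_of_isClique (fun x hx y hy hxy => ?_) hBC
      exact adj_of_addCliqueOnNbhd_adj hS hx hy
        (isBlockGraphOn_addCliqueOnNbhd hG hw hout C hC hx hy hxy)
    · push Not at hS
      obtain ⟨x, hxC, hxK, hxw⟩ := hS
      have hCK := hC.eq_insert_neighborSet hG hw hout hxC hxK hxw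
      have hcl : G.IsClique (insert v B) := by
        refine (hG B hB).insert fun y hy hvy => ?_
        rcases hCK ▸ hBC hy with h | h
        · exact absurd h.symm hvy
        · exact h
      exact absurd (hB.eq_of_isClique hcl (Set.subset_insert _ _) ▸ Set.mem_insert v B) hv

end CompletedNeighbourhood

/-- An interior or end vertex of a path of positive length lies on one of its edges. -/
lemma exists_mem_edges_of_mem_support {G : SimpleGraph V} {a b : V} (P : G.Walk a b)
    (hlen : 1 ≤ P.length) {x : V} (hx : x ∈ P.support) : ∃ e ∈ P.edges, x ∈ e := by
  induction P with
  | nil => simp at hlen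
  | @cons a c b h Q ih =>
    rw [SimpleGraph.Walk.support_cons, List.mem_cons] at hx
    rcases hx with rfl | hx
    · exact ⟨_, List.mem_cons_self .., by simp⟩
    · cases Q with
      | nil =>
        rw [SimpleGraph.Walk.support_nil, List.mem_singleton] at hx
        subst hx
        exact ⟨_, List.mem_cons_self .., by simp⟩
      | cons h' Q =>
        obtain ⟨e, he, hxe⟩ := ih (by simp) hx
        exact ⟨e, List.mem_cons_of_mem _ he, hxe⟩

lemma exists_walk_support_subset {G : SimpleGraph V} {a b : V} (P : G.Walk a b) {x y : V}
    (hx : x ∈ P.support) (hy : y ∈ P.support) :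
    ∃ Q : G.Walk x y, ∀ z ∈ Q.support, z ∈ P.support := by
  classical
  refine ⟨(P.takeUntil x hx).reverse.append (P.takeUntil y hy), fun z hz => ?_⟩
  rw [SimpleGraph.Walk.mem_support_append_iff, SimpleGraph.Walk.support_reverse,
    List.mem_reverse] at hz
  exact hz.elim (fun h => P.support_takeUntil_subset_support hx h)
    fun h => P.support_takeUntil_subset_support hy h

section AdjacentToSpine

variable {G : SimpleGraph V} {a b : V} {P : G.Walk a b} {v w : V}

/-- A vertex at distance one from a path is off the path and has a neighbour on it. -/
lemma exists_adj_of_distToPath_eq_one (hconn : G.Connected)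
    (h : distToPath G Set.univ P v = 1) : v ∉ P.support ∧ ∃ w ∈ P.support, G.Adj v w := by
  refine ⟨fun hv => by simp [distToPath_eq_zero_of_mem hv] at h, ?_⟩
  obtain ⟨y, hy, Q, hQ⟩ := exists_walk_length_eq_distToPath hconn P v
  exact ⟨y, hy, SimpleGraph.Walk.adj_of_length_eq_one (hQ.trans h)⟩

lemma mem_support_or_exists_adj_of_distToPath_le_one (hconn : G.Connected) {x : V}
    (h : distToPath G Set.univ P x ≤ 1) : x ∈ P.support ∨ ∃ y ∈ P.support, G.Adj x y := by
  by_cases hx : x ∈ P.support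
  · exact Or.inl hx
  obtain ⟨y, hy, Q, hQ⟩ := exists_walk_length_eq_distToPath hconn P x
  have hne : Q.length ≠ 0 := fun h0 => hx (SimpleGraph.Walk.eq_of_length_eq_zero h0 ▸ hy)
  exact Or.inr ⟨y, hy, SimpleGraph.Walk.adj_of_length_eq_one (p := Q) (by omega)⟩

/-- If large blocks are end-blocks, the block joining a cut vertex off the spine to the spine
is an edge. -/
lemma IsBlockGraphOn.ncard_lt_three [Finite V] (hG : IsBlockGraphOn G Set.univ)
    (hconn : G.Connected)
    (hend : ∀ B : Set V, IsBlockOn G Set.univ B → 3 ≤ B.ncard → IsEndBlockOn G Set.univ B)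
    (hspine : IsSpineOn G Set.univ P) (hlen : 1 ≤ P.length) (hcut : IsCutVtx G Set.univ v)
    (hv : v ∉ P.support) (hw : w ∈ P.support) {B : Set V} (hB : IsBlockOn G Set.univ B)
    (hvB : v ∈ B) (hwB : w ∈ B) : B.ncard < 3 := by
  by_contra! h
  obtain ⟨e, he, hwe⟩ := exists_mem_edges_of_mem_support P hlen hw
  have hvE : v ∉ {x | x ∈ e} := fun hve => hv (P.mem_support_of_mem_edges he hve)
  have hwcut := hG.isCutVtx_of_mem_of_mem hconn hB (hspine.2.1 e he)
    (fun h => hvE (h ▸ hvB)) hwB hwe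
  exact hv ((hend B hB h).2 ⟨hvB, hcut⟩ ⟨hwB, hwcut⟩ ▸ hw)

/-- If no block through `v` and `w` is large, then `v` and `w` have no common neighbour. -/
lemma not_adj_of_ncard_lt_three [Finite V]
    (hsmall : ∀ B : Set V, IsBlockOn G Set.univ B → v ∈ B → w ∈ B → B.ncard < 3)
    (hvw : G.Adj v w) {x : V} (hvx : G.Adj v x) : ¬ G.Adj x w := by
  intro hxw
  have hcl : G.IsClique {v, w, x} := by
    classical
    simpa using (SimpleGraph.is3Clique_triple_iff.2 ⟨hvw, hvx, hxw.symm⟩).isClique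
  obtain ⟨B, hsub, hB⟩ := exists_isBlockOn_of_isClique hcl (Set.insert_nonempty _ _)
  have h := hsmall B hB (hsub (by simp)) (hsub (by simp))
  exact absurd ((Set.two_lt_ncard).2 ⟨v, hsub (by simp), w, hsub (by simp), x, hsub (by simp),
    hvw.ne, hvx.ne, hxw.ne'⟩) (by omega)

/-- `w` is the only neighbour of `v` on the path. -/
lemma IsBlockGraphOn.eq_of_adj_of_mem_support [Finite V] (hG : IsBlockGraphOn G Set.univ)
    (hsmall : ∀ B : Set V, IsBlockOn G Set.univ B → v ∈ B → w ∈ B → B.ncard < 3)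
    (hv : v ∉ P.support) (hw : w ∈ P.support) (hvw : G.Adj v w) {y : V} (hy : y ∈ P.support)
    (hvy : G.Adj v y) : y = w := by
  by_contra hne
  obtain ⟨Q, hQ⟩ := exists_walk_support_subset P hy hw
  exact not_adj_of_ncard_lt_three hsmall hvw hvy (hG.adj_of_walk hvy hvw hne Q fun h => hv (hQ v h))

/-- If every cut vertex is at distance at most one from the path, the neighbours of `v` other
than `w` are not cut vertices. -/
lemma IsBlockGraphOn.not_isCutVtx_of_adj [Finite V] (hG : IsBlockGraphOn G Set.univ)
    (hconn : G.Connected)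
    (hsmall : ∀ B : Set V, IsBlockOn G Set.univ B → v ∈ B → w ∈ B → B.ncard < 3)
    (hdist : ∀ x : V, IsCutVtx G Set.univ x → distToPath G Set.univ P x ≤ 1)
    (hv : v ∉ P.support) (hw : w ∈ P.support) (hvw : G.Adj v w) {x : V} (hvx : G.Adj v x)
    (hxw : x ≠ w) : ¬ IsCutVtx G Set.univ x := by
  intro hx
  rcases mem_support_or_exists_adj_of_distToPath_le_one hconn (hdist x hx) with hxP | ⟨y, hy, hxy⟩
  · exact hxw (hG.eq_of_adj_of_mem_support hsmall hv hw hvw hxP hvx)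
  · obtain ⟨Q, hQ⟩ := exists_walk_support_subset P hy hw
    refine not_adj_of_ncard_lt_three hsmall hvw hvx (hG.adj_of_walk hvx hvw hxw (.cons hxy Q) ?_)
    rw [SimpleGraph.Walk.support_cons, List.mem_cons, not_or]
    exact ⟨hvx.ne, fun h => hv (hQ v h)⟩

/-- The neighbours of a non-cut vertex adjacent to `v` lie in the closed neighbourhood of `v`. -/
lemma IsBlockGraphOn.mem_insert_neighborSet_of_adj [Finite V] (hG : IsBlockGraphOn G Set.univ)
    (hconn : G.Connected) {x z : V} (hvx : G.Adj v x) (hx : ¬ IsCutVtx G Set.univ x)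
    (hxz : G.Adj x z) : z ∈ insert v (G.neighborSet v) := by
  obtain ⟨B, hB, hvB, hxB⟩ := exists_isBlockOn_of_adj hvx
  obtain ⟨C, hC, hxC, hzC⟩ := exists_isBlockOn_of_adj hxz
  obtain rfl : B = C := by
    by_contra hne
    exact hx (hG.isCutVtx_of_mem_of_mem hconn hB hC hne hxB hxC)
  rcases eq_or_ne v z with rfl | hvz
  · exact Set.mem_insert _ _
  · exact Or.inr (hG B hB hvB hzC hvz)

end AdjacentToSpine

/-- **Case II of the proof, `d(v,P) = 1`.** With `G'` obtained from `G` by completing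
the neighbourhood of `v`: if `d(v,P) = 1` then `b(G') = b(G) + 1` and
`lbd_{G'}(u) = lbd_G(u)` for every `u ∈ C_{G'}`; consequently
`Σ_{x ∈ C_G} max(lbd_G x, 2) = Σ_{x ∈ C_{G'}} max(lbd_{G'} x, 2) + max(lbd_G v, 2)`. -/
theorem case_bd_ge_three_dist_one {V : Type*} [Fintype V] (G : SimpleGraph V)
    (hconn : G.Connected)
    (hblock : IsBlockGraphOn G Set.univ)
    (hend : ∀ B : Set V, IsBlockOn G Set.univ B → 3 ≤ B.ncard → IsEndBlockOn G Set.univ B)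
    {a b : V} (P : G.Walk a b)
    (hspine : IsSpineOn G Set.univ P) (hlen : 1 ≤ P.length)
    (v : V) (hcut : IsCutVtx G Set.univ v)
    (hmaxdist : ∀ x : V, IsCutVtx G Set.univ x →
      distToPath G Set.univ P x ≤ distToPath G Set.univ P v)
    (hbd : 3 ≤ bd G Set.univ v)
    (G' : SimpleGraph V) (hG' : G' = addCliqueOnNbhd G v)
    (P' : G'.Walk a b) (hP' : P' = P.mapLe (hG' ▸ le_addCliqueOnNbhd G v))
    (hdist : distToPath G Set.univ P v = 1) :
    bcount G' Set.univ P' = bcount G Set.univ P + 1 ∧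
    (∀ u ∈ Cset G' Set.univ P', lbd G' Set.univ u = lbd G Set.univ u) ∧
    (∑ᶠ x ∈ Cset G Set.univ P, max (lbd G Set.univ x) 2) =
      (∑ᶠ x ∈ Cset G' Set.univ P', max (lbd G' Set.univ x) 2) +
        max (lbd G Set.univ v) 2 := by
  have hle : G ≤ G' := hG' ▸ le_addCliqueOnNbhd G v
  have hsupp : P'.support = P.support := by
    rw [hP', SimpleGraph.Walk.support_mapLe_eq_support]
  clear hP'
  rw [hdist] at hmaxdist
  obtain ⟨hvP, w, hwP, hvw⟩ := exists_adj_of_distToPath_eq_one hconn hdist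
  have hsmall : ∀ B : Set V, IsBlockOn G Set.univ B → v ∈ B → w ∈ B → B.ncard < 3 :=
    fun B => hblock.ncard_lt_three hconn hend hspine hlen hcut hvP hwP
  have huniq : ∀ y ∈ P.support, G.Adj v y → y = w :=
    fun y => hblock.eq_of_adj_of_mem_support hsmall hvP hwP hvw
  have hnoncut : ∀ x, G.Adj v x → x ≠ w → ¬ IsCutVtx G Set.univ x :=
    fun x => hblock.not_isCutVtx_of_adj hconn hsmall hmaxdist hvP hwP hvw
  have hout : ∀ x, G.Adj v x → x ≠ w → ∀ z, G.Adj x z → z ∈ insert v (G.neighborSet v) :=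
    fun x hx hxw z => hblock.mem_insert_neighborSet_of_adj hconn hx (hnoncut x hx hxw)
  set K := insert v (G.neighborSet v) with hK
  have hconn' : G'.Connected := hconn.mono hle
  have hiff : ∀ {B}, IsBlockOn G' Set.univ B ↔ B = K ∨ (IsBlockOn G Set.univ B ∧ v ∉ B) :=
    hG' ▸ isBlockOn_addCliqueOnNbhd_iff hblock hvw hout
  have hvK : v ∈ K := Set.mem_insert _ _
  have hwK : w ∈ K := Or.inr hvw
  have hKclique : G'.IsClique K :=
    hG' ▸ isClique_addCliqueOnNbhd_insert_neighborSet
  have hsub : ∀ {B}, IsBlockOn G Set.univ B → v ∈ B → B ⊆ K := by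
    intro B hB hvB x hx
    rcases eq_or_ne v x with rfl | hne
    · exact hvK
    · exact Or.inr (hblock B hB hvB hx hne)
  have hvcut' : ¬ IsCutVtx G' Set.univ v := by
    refine not_isCutVtx_of_isClique_neighborSet hconn' (hKclique.subset fun x hx => ?_)
    exact mem_insert_neighborSet_of_addCliqueOnNbhd_adj hout hvK hvw.ne (hG' ▸ hx)
  have hKend : IsEndBlockOn G' Set.univ K := by
    refine ⟨hiff.2 (Or.inl rfl), fun x hx y hy => ?_⟩
    have : ∀ x ∈ {x ∈ K | IsCutVtx G' Set.univ x}, x = w := by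
      rintro x ⟨hxK | hxK, hx⟩
      · exact absurd (hxK ▸ hx) hvcut'
      · by_contra hxw
        exact hnoncut x hxK hxw (hx.of_le hle hconn)
    rw [this x hx, this y hy]
  have hKcard : 3 ≤ K.ncard := by
    obtain ⟨B, hB, hvB, hwB⟩ := exists_isBlockOn_of_adj hvw
    obtain ⟨C, ⟨hC, hvC⟩, hCB⟩ := Set.exists_ne_of_one_lt_ncard
      (s := {B : Set V | IsBlockOn G Set.univ B ∧ v ∈ B})
      (show 1 < _ from lt_of_lt_of_le (by norm_num) hbd) B
    obtain ⟨x, hxC, hxB⟩ : ∃ x ∈ C, x ∉ B := by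
      by_contra! h
      exact hCB (hC.eq_of_isClique (hblock B hB) h).symm
    exact (Set.two_lt_ncard).2 ⟨v, hvK, w, hwK, x, hsub hC hvC hxC, hvw.ne,
      fun h => hxB (h ▸ hvB), fun h => hxB (h ▸ hwB)⟩
  have hblocks : ∀ {u}, u ∉ K → ∀ {B}, u ∈ B →
      (IsBlockOn G' Set.univ B ↔ IsBlockOn G Set.univ B) := by
    intro u hu B huB
    rw [hiff]
    constructor
    · rintro (rfl | h)
      exacts [absurd huB hu, h.1]
    · exact fun h => Or.inr ⟨h, fun hv => hu (hsub h hv huB)⟩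
  have hbdeq : ∀ {u}, u ∉ K → bd G' Set.univ u = bd G Set.univ u := by
    intro u hu
    unfold bd
    congr 1
    ext B
    exact and_congr_left fun huB => hblocks hu huB
  have hlbdeq : ∀ {u}, u ∉ K → lbd G' Set.univ u = lbd G Set.univ u := by
    intro u hu
    unfold lbd
    congr 1
    ext B
    exact and_congr_left fun h => hblocks hu h.1
  have hCset' : ∀ {u}, u ∈ Cset G' Set.univ P' → u ∉ K := by
    rintro u ⟨-, huP, hu⟩ huK
    rw [hsupp] at huP
    have huw : u ≠ w := fun h => huP (h ▸ hwP)
    have hone : {B : Set V | IsBlockOn G' Set.univ B ∧ u ∈ B} ⊆ {K} :=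
      fun B hB => (hG' ▸ hB.1 : IsBlockOn (addCliqueOnNbhd G v) Set.univ B).eq_insert_neighborSet
        hblock hvw hout hB.2 huK huw
    have := Set.ncard_le_ncard hone
    rw [Set.ncard_singleton] at this
    exact absurd (hu.trans this) (by norm_num)
  have hCset : Cset G Set.univ P = insert v (Cset G' Set.univ P') := by
    ext u
    constructor
    · rintro ⟨-, huP, hu⟩
      rcases eq_or_ne u v with rfl | huv
      · exact Set.mem_insert _ _
      have huK : u ∉ K := by
        rintro (h | h)
        · exact huv h
        · exact hnoncut u h (fun h => huP (h ▸ hwP))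
            (hblock.isCutVtx_of_one_lt_bd hconn (lt_of_lt_of_le (by norm_num) hu))
      exact Or.inr ⟨Set.mem_univ _, hsupp ▸ huP, (hbdeq huK).symm ▸ hu⟩
    · rintro (rfl | hu)
      · exact ⟨Set.mem_univ _, hvP, hbd⟩
      · exact ⟨Set.mem_univ _, hsupp ▸ hu.2.1, hbdeq (hCset' hu) ▸ hu.2.2⟩
  have hlbd : ∀ u ∈ Cset G' Set.univ P', lbd G' Set.univ u = lbd G Set.univ u :=
    fun u hu => hlbdeq (hCset' hu)
  refine ⟨?_, hlbd, ?_⟩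
  · have hset : {B : Set V | IsEndBlockOn G' Set.univ B ∧ 3 ≤ B.ncard ∧ ∃ x ∈ B, x ∈ P'.support} =
        insert K {B : Set V | IsEndBlockOn G Set.univ B ∧ 3 ≤ B.ncard ∧
          ∃ x ∈ B, x ∈ P.support} := by
      ext B
      simp only [hsupp]
      constructor
      · rintro ⟨hB, hcard, hP⟩
        rcases hiff.1 hB.1 with rfl | h
        · exact Set.mem_insert _ _
        · exact Or.inr ⟨hend B h.1 hcard, hcard, hP⟩
      · rintro (rfl | ⟨hB, hcard, x, hxB, hxP⟩)
        · exact ⟨hKend, hKcard, w, hwK, hwP⟩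
        · have hvB : v ∉ B := by
            intro hvB
            have hxw := huniq x hxP (hblock B hB.1 hvB hxB fun h => hvP (h ▸ hxP))
            exact absurd (hsmall B hB.1 hvB (hxw ▸ hxB)) (by omega)
          refine ⟨⟨hiff.2 (Or.inr ⟨hB.1, hvB⟩), hB.2.anti fun y hy => ?_⟩, hcard, x, hxB, hxP⟩
          exact ⟨hy.1, hy.2.of_le hle hconn⟩
    unfold bcount
    rw [hset, Set.ncard_insert_of_notMem]
    rintro ⟨hKb, -, -⟩
    exact absurd (hsmall K hKb.1 hvK hwK) (by omega)
  · rw [hCset, finsum_mem_insert _ (fun h => hCset' h hvK) (Set.toFinite _), add_comm]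
    congr 1
    exact finsum_mem_congr rfl fun u hu => by rw [hlbd u hu]

end BEIReg
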